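/- arXiv:2309.08024 — 2 statements merged into one kernel-verified Lean document; each statement's English description precedes it below -/
import Mathlib

section
/- Let n ≥ 1, let 0 = s̃₀ < s̃₁ < ⋯ < s̃ₙ < s̃_{n+1} = 1, let c₁, …, cₙ > 0, and set t₀ := 0 and t_k := c₁ + ⋯ + c_k for 1 ≤ k ≤ n. Then the following identity of absolutely convergent Lebesgue integrals holds: ∫_{(0,∞)ⁿ} exp(−Σ_{k=1}^{n} c_k x_k) · √(8π) h_{1−s̃₁}(x₁) h̃_{s̃₁}(x₁) · Π_{k=1}^{n−1} [ (h̃_{s̃_{k+1}}(x_{k+1}) / h̃_{s̃_k}(x_k)) · p̃_{s̃_{k+1}−s̃_k}(x_k, x_{k+1}) ] dx₁⋯dxₙ = √(2/π) ∫_{(0,∞)^{n+1}} exp(−(1/2) Σ_{k=0}^{n} (s̃_{k+1} − s̃_k) y_k²) · Π_{k=1}^{n} q_{t_k − t_{k−1}}(y_k, y_{k−1}) dy₀⋯dyₙ. (The left side is E[exp(−Σ_{k=1}^{n} c_k B^{me}_{s̃_k})] for the Brownian meander; the right side is √(2/π)∫₀^∞ E[exp(−(1/2)Σ_{k=0}^{n}(s̃_{k+1}−s̃_k)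 Y_{t_k}²) | Y_{tₙ} = y] dy, written via the reversed transition kernels of the radial Cauchy process.) -/
open MeasureTheory

/-- Transition subprobability density of Brownian motion killed at 0. -/
noncomputable def ptilde (t x₁ x₂ : ℝ) : ℝ :=
  (Real.sqrt (2 * Real.pi * t))⁻¹ *
    (Real.exp (-(x₁ - x₂) ^ 2 / (2 * t)) - Real.exp (-(x₁ + x₂) ^ 2 / (2 * t)))

/-- `h_s(x) = x·(2π(1−s)³)^{−1/2}·exp(−x²/(2(1−s)))`. -/
noncomputable def hexc (s x : ℝ) : ℝ :=
  x / Real.sqrt (2 * Real.pi * (1 - s) ^ 3) * Real.exp (-x ^ 2 / (2 * (1 - s)))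

/-- `h̃_s(x) = (2π(1−s))^{−1/2}·∫₀ˣ exp(−u²/(2(1−s))) du`. -/
noncomputable def htil (s x : ℝ) : ℝ :=
  (Real.sqrt (2 * Real.pi * (1 - s)))⁻¹ * ∫ u in (0 : ℝ)..x, Real.exp (-u ^ 2 / (2 * (1 - s)))

/-- Transition density of the radial part of a three-dimensional Cauchy process. -/
noncomputable def qrad (t y₁ y₂ : ℝ) : ℝ :=
  (y₂ / y₁) * (1 / Real.pi) *
    (t / (t ^ 2 + (y₁ - y₂) ^ 2) - t / (t ^ 2 + (y₁ + y₂) ^ 2))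

/-- Extension of a vector `x : Fin n → ℝ` to a function on `ℕ` (by zero). -/
def ext (n : ℕ) (x : Fin n → ℝ) (k : ℕ) : ℝ := if h : k < n then x ⟨k, h⟩ else 0

/-- Cosine transform of the Gaussian on the half-line. -/
lemma integral_Ioi_exp_neg_mul_sq_mul_cos {τ : ℝ} (hτ : 0 < τ) (a : ℝ) :
    ∫ y in Set.Ioi (0 : ℝ), Real.exp (-(τ / 2) * y ^ 2) * Real.cos (a * y) =
      Real.pi * ((Real.sqrt (2 * Real.pi * τ))⁻¹ * Real.exp (-a ^ 2 / (2 * τ))) := by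
  have h := fourierIntegral_gaussian (b := ((τ / 2 : ℝ) : ℂ)) (by simpa using hτ) (a : ℂ)
  have hint : Integrable (fun x : ℝ => Complex.exp (Complex.I * a * x) *
      Complex.exp (-((τ / 2 : ℝ) : ℂ) * (x : ℂ) ^ 2)) := by
    refine (integrable_cexp_neg_mul_sq (b := ((τ / 2 : ℝ) : ℂ)) (by simpa using hτ)).bdd_mul
      (c := 1) (by fun_prop) (Filter.Eventually.of_forall fun x => ?_)
    rw [show Complex.I * a * x = ((a * x : ℝ) : ℂ) * Complex.I by push_cast; ring,
      Complex.norm_exp_ofReal_mul_I]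
  have hre := congrArg Complex.re h
  rw [← RCLike.re_eq_complex_re, ← integral_re hint] at hre
  have hl : ∀ x : ℝ, RCLike.re (Complex.exp (Complex.I * a * x) *
      Complex.exp (-((τ / 2 : ℝ) : ℂ) * (x : ℂ) ^ 2)) =
      (fun y => Real.exp (-(τ / 2) * y ^ 2) * Real.cos (a * y)) |x| := by
    intro x
    rw [show Complex.I * a * x = ((a * x : ℝ) : ℂ) * Complex.I by push_cast; ring,
      show -((τ / 2 : ℝ) : ℂ) * (x : ℂ) ^ 2 = ((-(τ / 2) * x ^ 2 : ℝ) : ℂ) by push_cast; ring,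
      ← Complex.ofReal_exp, RCLike.re_eq_complex_re, Complex.re_mul_ofReal,
      Complex.exp_ofReal_mul_I_re]
    have hc : Real.cos (a * |x|) = Real.cos (a * x) := by
      rw [← Real.cos_abs, abs_mul, abs_abs, ← abs_mul, Real.cos_abs]
    simp only [sq_abs, hc]
    ring
  rw [integral_congr_ae (Filter.Eventually.of_forall hl),
    integral_comp_abs (f := fun y => Real.exp (-(τ / 2) * y ^ 2) * Real.cos (a * y))] at hre
  have hr : RCLike.re (((Real.pi : ℂ) / ((τ / 2 : ℝ) : ℂ)) ^ (1 / 2 : ℂ) *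
      Complex.exp (-(a : ℂ) ^ 2 / (4 * ((τ / 2 : ℝ) : ℂ)))) =
      Real.sqrt (Real.pi / (τ / 2)) * Real.exp (-a ^ 2 / (2 * τ)) := by
    have h1 : (((Real.pi : ℂ) / ((τ / 2 : ℝ) : ℂ)) ^ (1 / 2 : ℂ)) =
        ((Real.sqrt (Real.pi / (τ / 2)) : ℝ) : ℂ) := by
      rw [Real.sqrt_eq_rpow, Complex.ofReal_cpow (by positivity)]
      push_cast
      rfl
    have h2 : Complex.exp (-(a : ℂ) ^ 2 / (4 * ((τ / 2 : ℝ) : ℂ))) =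
        ((Real.exp (-a ^ 2 / (2 * τ)) : ℝ) : ℂ) := by
      push_cast
      congr 2
      ring
    rw [h1, h2, ← Complex.ofReal_mul]
    rfl
  rw [hr] at hre
  have hs : Real.sqrt (Real.pi / (τ / 2)) = 2 * Real.pi * (Real.sqrt (2 * Real.pi * τ))⁻¹ := by
    rw [Real.sqrt_eq_iff_mul_self_eq (by positivity) (by positivity)]
    have hm : Real.sqrt (2 * Real.pi * τ) * Real.sqrt (2 * Real.pi * τ) = 2 * Real.pi * τ :=
      Real.mul_self_sqrt (by positivity)
    have : 2 * Real.pi * (Real.sqrt (2 * Real.pi * τ))⁻¹ *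
        (2 * Real.pi * (Real.sqrt (2 * Real.pi * τ))⁻¹) = 4 * Real.pi ^ 2 *
        (Real.sqrt (2 * Real.pi * τ) * Real.sqrt (2 * Real.pi * τ))⁻¹ := by
      rw [mul_inv]; ring
    rw [this, hm]
    field_simp
    norm_num
  rw [hs] at hre
  linarith

lemma integrableOn_Ioi_exp_neg_mul_sq {τ : ℝ} (hτ : 0 < τ) :
    IntegrableOn (fun y : ℝ => Real.exp (-(τ / 2) * y ^ 2)) (Set.Ioi 0) :=
  (integrable_exp_neg_mul_sq (half_pos hτ)).integrableOn

lemma integrableOn_Ioi_exp_neg_mul_sq_mul_cos {τ : ℝ} (hτ : 0 < τ) (a : ℝ) :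
    IntegrableOn (fun y : ℝ => Real.exp (-(τ / 2) * y ^ 2) * Real.cos (a * y)) (Set.Ioi 0) :=
  (integrableOn_Ioi_exp_neg_mul_sq hτ).mul_bdd (c := 1) (by fun_prop)
    (Filter.Eventually.of_forall fun y => by simpa using Real.abs_cos_le_one _)

/-- Spectral representation of the killed heat kernel. -/
lemma integral_Ioi_exp_neg_mul_sq_mul_sin_mul_sin {τ : ℝ} (hτ : 0 < τ) (a b : ℝ) :
    ∫ y in Set.Ioi (0 : ℝ), Real.exp (-(τ / 2) * y ^ 2) * Real.sin (a * y) * Real.sin (b * y) =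
      Real.pi / 2 * ptilde τ a b := by
  have h : ∀ y : ℝ, Real.exp (-(τ / 2) * y ^ 2) * Real.sin (a * y) * Real.sin (b * y) =
      1 / 2 * (Real.exp (-(τ / 2) * y ^ 2) * Real.cos ((a - b) * y) -
        Real.exp (-(τ / 2) * y ^ 2) * Real.cos ((a + b) * y)) := by
    intro y
    rw [sub_mul, add_mul, Real.cos_sub, Real.cos_add]
    ring
  simp_rw [h]
  rw [integral_const_mul, integral_sub (integrableOn_Ioi_exp_neg_mul_sq_mul_cos hτ _)
    (integrableOn_Ioi_exp_neg_mul_sq_mul_cos hτ _), integral_Ioi_exp_neg_mul_sq_mul_cos hτ,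
    integral_Ioi_exp_neg_mul_sq_mul_cos hτ, ptilde]
  ring

/-- Spectral representation of the Brownian hitting density. -/
lemma integral_Ioi_exp_neg_mul_sq_mul_id_mul_sin {τ : ℝ} (hτ : 0 < τ) (a : ℝ) :
    ∫ y in Set.Ioi (0 : ℝ), Real.exp (-(τ / 2) * y ^ 2) * y * Real.sin (a * y) =
      Real.pi * hexc (1 - τ) a := by
  have hb : ∀ y : ℝ, ‖Real.sin (a * y)‖ ≤ 1 := fun y => by simpa using Real.abs_sin_le_one _
  have hi : IntegrableOn (fun y : ℝ => Real.exp (-(τ / 2) * y ^ 2) * y * Real.sin (a * y))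
      (Set.Ioi 0) := by
    refine Integrable.mul_bdd (c := 1) ?_ (by fun_prop) (Filter.Eventually.of_forall hb)
    simpa only [mul_comm] using
      (integrable_mul_exp_neg_mul_sq (half_pos hτ)).restrict (s := Set.Ioi 0)
  have hc := integrableOn_Ioi_exp_neg_mul_sq_mul_cos hτ a
  have key := integral_Ioi_of_hasDerivAt_of_tendsto' (a := 0) (m := 0)
    (f := fun y : ℝ => -(Real.exp (-(τ / 2) * y ^ 2) * Real.sin (a * y)) / τ)
    (f' := fun y : ℝ => Real.exp (-(τ / 2) * y ^ 2) * y * Real.sin (a * y) -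
      a / τ * (Real.exp (-(τ / 2) * y ^ 2) * Real.cos (a * y))) (by
      intro y _
      have h1 : HasDerivAt (fun y : ℝ => Real.exp (-(τ / 2) * y ^ 2))
          (Real.exp (-(τ / 2) * y ^ 2) * (-(τ / 2) * (2 * y))) y := by
        simpa using ((hasDerivAt_pow 2 y).const_mul (-(τ / 2))).exp
      have h2 : HasDerivAt (fun y : ℝ => Real.sin (a * y)) (Real.cos (a * y) * a) y := by
        simpa using ((hasDerivAt_id y).const_mul a).sin
      refine ((h1.mul h2).neg.div_const τ).congr_deriv ?_
      field_simp
      ring) (hi.sub (hc.const_mul _)) (by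
      have ht : Filter.Tendsto (fun y : ℝ => Real.exp (-(τ / 2) * y ^ 2)) Filter.atTop
          (nhds 0) := by
        refine Real.tendsto_exp_atBot.comp ?_
        exact (Filter.tendsto_pow_atTop two_ne_zero).const_mul_atTop_of_neg (by linarith)
      have h0 := ht.zero_mul_isBoundedUnder_le (g := fun y => Real.sin (a * y))
        (Filter.isBoundedUnder_of ⟨1, hb⟩)
      simpa using h0.neg.div_const τ)
  rw [integral_sub hi (hc.const_mul _), integral_const_mul,
    integral_Ioi_exp_neg_mul_sq_mul_cos hτ] at key
  have hs : Real.sqrt (2 * Real.pi * τ ^ 3) = Real.sqrt (2 * Real.pi * τ) * τ := by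
    rw [show 2 * Real.pi * τ ^ 3 = 2 * Real.pi * τ * τ ^ 2 by ring,
      Real.sqrt_mul (by positivity), Real.sqrt_sq hτ.le]
  simp only [mul_zero, Real.sin_zero, neg_zero, zero_div, sub_zero] at key
  rw [hexc, sub_sub_cancel, hs]
  rw [sub_eq_zero] at key
  rw [key]
  field_simp

/-- Spectral representation of the Brownian survival probability. -/
lemma integral_Ioi_exp_neg_mul_sq_mul_sin_div {τ : ℝ} (hτ : 0 < τ) (a : ℝ) :
    ∫ y in Set.Ioi (0 : ℝ), Real.exp (-(τ / 2) * y ^ 2) * Real.sin (a * y) * y⁻¹ =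
      Real.pi * htil (1 - τ) a := by
  have hint : Integrable (Function.uncurry fun u y : ℝ =>
      Real.exp (-(τ / 2) * y ^ 2) * Real.cos (u * y))
      ((volume.restrict (Set.uIoc 0 a)).prod (volume.restrict (Set.Ioi 0))) := by
    have h1 : Integrable (fun _ : ℝ => (1 : ℝ)) (volume.restrict (Set.uIoc 0 a)) :=
      integrableOn_const (by simp [Set.uIoc])
    have h2 := h1.mul_prod (integrableOn_Ioi_exp_neg_mul_sq hτ)
    refine h2.mono' (by fun_prop) (Filter.Eventually.of_forall fun z => ?_)
    simp only [Function.uncurry, norm_mul, Real.norm_eq_abs, Real.abs_exp, one_mul]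
    exact mul_le_of_le_one_right (Real.exp_pos _).le (Real.abs_cos_le_one _)
  have h := intervalIntegral_integral_swap hint
  simp_rw [integral_Ioi_exp_neg_mul_sq_mul_cos hτ, intervalIntegral.integral_const_mul] at h
  rw [htil, sub_sub_cancel, h]
  refine setIntegral_congr_fun measurableSet_Ioi fun y hy => ?_
  have hy0 : y ≠ 0 := ne_of_gt hy
  simp only [intervalIntegral.integral_comp_mul_right (fun u => Real.cos u) hy0]
  simp
  ring

lemma integrableOn_Ioi_exp_neg_mul_mul_cos {c : ℝ} (hc : 0 < c) (a : ℝ) :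
    IntegrableOn (fun x : ℝ => Real.exp (-c * x) * Real.cos (a * x)) (Set.Ioi 0) :=
  (exp_neg_integrableOn_Ioi 0 hc).mul_bdd (c := 1) (by fun_prop)
    (Filter.Eventually.of_forall fun y => by simpa using Real.abs_cos_le_one _)

/-- Laplace transform of the cosine. -/
lemma integral_Ioi_exp_neg_mul_mul_cos {c : ℝ} (hc : 0 < c) (a : ℝ) :
    ∫ x in Set.Ioi (0 : ℝ), Real.exp (-c * x) * Real.cos (a * x) = c / (c ^ 2 + a ^ 2) := by
  have hpos : c ^ 2 + a ^ 2 ≠ 0 := by positivity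
  rw [integral_Ioi_of_hasDerivAt_of_tendsto' (a := 0) (m := 0)
    (f := fun x : ℝ => Real.exp (-c * x) *
      ((-c * Real.cos (a * x) + a * Real.sin (a * x)) / (c ^ 2 + a ^ 2))) _
      (integrableOn_Ioi_exp_neg_mul_mul_cos hc a)]
  · simp
    ring
  · have ht : Filter.Tendsto (fun x : ℝ => Real.exp (-c * x)) Filter.atTop (nhds 0) :=
      Real.tendsto_exp_atBot.comp (Filter.tendsto_id.const_mul_atTop_of_neg (by linarith))
    refine ht.zero_mul_isBoundedUnder_le
      (Filter.isBoundedUnder_of ⟨(c + |a|) / (c ^ 2 + a ^ 2), fun x => ?_⟩)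
    simp only [Function.comp, Real.norm_eq_abs, abs_div, abs_of_nonneg (by positivity :
      0 ≤ c ^ 2 + a ^ 2)]
    gcongr
    refine (abs_add_le _ _).trans ?_
    rw [abs_mul, abs_mul, abs_neg, abs_of_pos hc]
    gcongr
    · exact mul_le_of_le_one_right hc.le (Real.abs_cos_le_one _)
    · exact mul_le_of_le_one_right (abs_nonneg a) (Real.abs_sin_le_one _)
  · intro x _
    have h1 : HasDerivAt (fun x : ℝ => Real.exp (-c * x)) (Real.exp (-c * x) * -c) x := by
      simpa using ((hasDerivAt_id x).const_mul (-c)).exp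
    have h2 : HasDerivAt (fun y : ℝ => Real.sin (a * y)) (Real.cos (a * x) * a) x := by
      simpa using ((hasDerivAt_id x).const_mul a).sin
    have h3 : HasDerivAt (fun y : ℝ => Real.cos (a * y)) (-Real.sin (a * x) * a) x := by
      simpa using ((hasDerivAt_id x).const_mul a).cos
    refine (h1.mul (((h3.const_mul (-c)).add
      (h2.const_mul a)).div_const (c ^ 2 + a ^ 2))).congr_deriv ?_
    simp only [Pi.add_apply]
    field_simp
    ring

/-- Laplace transform of a product of sines. -/
lemma integral_Ioi_exp_neg_mul_mul_sin_mul_sin {c : ℝ} (hc : 0 < c) (a b : ℝ) :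
    ∫ x in Set.Ioi (0 : ℝ), Real.exp (-c * x) * (Real.sin (x * a) * Real.sin (x * b)) =
      1 / 2 * (c / (c ^ 2 + (a - b) ^ 2) - c / (c ^ 2 + (a + b) ^ 2)) := by
  have h : ∀ x : ℝ, Real.exp (-c * x) * (Real.sin (x * a) * Real.sin (x * b)) =
      1 / 2 * (Real.exp (-c * x) * Real.cos ((a - b) * x) -
        Real.exp (-c * x) * Real.cos ((a + b) * x)) := by
    intro x
    rw [sub_mul, add_mul, Real.cos_sub, Real.cos_add, mul_comm x a, mul_comm x b]
    ring
  simp_rw [h]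
  rw [integral_const_mul, integral_sub (integrableOn_Ioi_exp_neg_mul_mul_cos hc _)
    (integrableOn_Ioi_exp_neg_mul_mul_cos hc _), integral_Ioi_exp_neg_mul_mul_cos hc,
    integral_Ioi_exp_neg_mul_mul_cos hc]

lemma htil_pos {s x : ℝ} (hs : s < 1) (hx : 0 < x) : 0 < htil s x := by
  have hs' : 0 < 1 - s := sub_pos.2 hs
  refine mul_pos (by positivity) ?_
  refine intervalIntegral.intervalIntegral_pos_of_pos ?_ (fun _ => Real.exp_pos _) hx
  exact Continuous.intervalIntegrable (by fun_prop) _ _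

lemma mul_prod_range_div_eq {f : ℕ → ℝ} {m : ℕ} (hf : ∀ k < m, f k ≠ 0) :
    f 0 * ∏ k ∈ Finset.range m, f (k + 1) / f k = f m := by
  induction m with
  | zero => simp
  | succ m ih =>
    rw [Finset.prod_range_succ, ← mul_assoc, ih fun k hk => hf k (by omega),
      mul_div_cancel₀ _ (hf m (by omega))]

lemma measurable_ext (n k : ℕ) : Measurable fun x : Fin n → ℝ => ext n x k := by
  unfold ext
  split_ifs <;> fun_prop

lemma prod_range_ext {n : ℕ} (f : ℕ → ℝ → ℝ) (x : Fin n → ℝ) :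
    ∏ k ∈ Finset.range n, f k (ext n x k) = ∏ k : Fin n, f k (x k) := by
  rw [Finset.prod_range]
  simp [ext]

lemma integral_prod_range_ext {n : ℕ} (f : ℕ → ℝ → ℝ) (μ : Measure ℝ) [SigmaFinite μ] :
    ∫ x : Fin n → ℝ, ∏ k ∈ Finset.range n, f k (ext n x k) ∂(Measure.pi fun _ => μ) =
      ∏ k ∈ Finset.range n, ∫ x, f k x ∂μ := by
  simp_rw [prod_range_ext, Finset.prod_range]
  exact integral_fintype_prod_eq_prod fun (k : Fin n) x => f k x

lemma integrable_prod_range_ext {n : ℕ} {f : ℕ → ℝ → ℝ} {μ : Measure ℝ} [SigmaFinite μ]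
    (hf : ∀ k < n, Integrable (f k) μ) :
    Integrable (fun x : Fin n → ℝ => ∏ k ∈ Finset.range n, f k (ext n x k))
      (Measure.pi fun _ => μ) := by
  simp_rw [prod_range_ext]
  exact Integrable.fintype_prod fun k : Fin n => hf k k.2

lemma ae_pi_restrict_Ioi_ext_pos (n : ℕ) :
    ∀ᵐ x : Fin n → ℝ ∂(Measure.pi fun _ => volume.restrict (Set.Ioi (0 : ℝ))),
      ∀ k < n, 0 < ext n x k := by
  have h : ∀ k : Fin n, ∀ᵐ x : Fin n → ℝ
      ∂(Measure.pi fun _ => volume.restrict (Set.Ioi (0 : ℝ))), 0 < x k := fun k =>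
    Measure.tendsto_eval_ae_ae.eventually (ae_restrict_mem (measurableSet_Ioi (a := (0 : ℝ))))
  filter_upwards [ae_all_iff.2 h] with x hx k hk
  simpa [ext, hk] using hx ⟨k, hk⟩

/-- The joint kernel whose partial integrals give, up to constants, the two sides of the duality:
`X 0, …, X m` are the spatial variables and `Y 0, …, Y (m + 1)` the frequencies. -/
noncomputable def dualKernel (m : ℕ) (s c X Y : ℕ → ℝ) : ℝ :=
  (∏ k ∈ Finset.range (m + 1), Real.exp (-c (k + 1) * X k)) *
    (∏ k ∈ Finset.range (m + 2), Real.exp (-((s (k + 1) - s k) / 2) * Y k ^ 2)) *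
    (Y 0 * (Y (m + 1))⁻¹ *
      ∏ k ∈ Finset.range (m + 1), (Real.sin (X k * Y (k + 1)) * Real.sin (X k * Y k)))

/-- The part of `dualKernel` that depends on the `k`-th frequency. -/
noncomputable def freqFactor (m : ℕ) (s X : ℕ → ℝ) (k : ℕ) (y : ℝ) : ℝ :=
  Real.exp (-((s (k + 1) - s k) / 2) * y ^ 2) *
    (if k = 0 then y else Real.sin (X (k - 1) * y)) *
    (if k = m + 1 then y⁻¹ else Real.sin (X k * y))

lemma dualKernel_eq_prod_freqFactor (m : ℕ) (s c X Y : ℕ → ℝ) :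
    dualKernel m s c X Y = (∏ k ∈ Finset.range (m + 1), Real.exp (-c (k + 1) * X k)) *
      ∏ k ∈ Finset.range (m + 2), freqFactor m s X k (Y k) := by
  have h1 : ∏ k ∈ Finset.range (m + 2), (if k = 0 then Y k else Real.sin (X (k - 1) * Y k)) =
      (∏ k ∈ Finset.range (m + 1), Real.sin (X k * Y (k + 1))) * Y 0 := by
    rw [Finset.prod_range_succ']
    simp
  have h2 : ∏ k ∈ Finset.range (m + 2), (if k = m + 1 then (Y k)⁻¹ else Real.sin (X k * Y k)) =
      (∏ k ∈ Finset.range (m + 1), Real.sin (X k * Y k)) * (Y (m + 1))⁻¹ := by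
    rw [Finset.prod_range_succ, if_pos rfl]
    congr 1
    refine Finset.prod_congr rfl fun k hk => if_neg ?_
    have := Finset.mem_range.1 hk
    omega
  simp only [freqFactor, Finset.prod_mul_distrib, h1, h2, dualKernel]
  ring

lemma dualKernel_eq_prod_space (m : ℕ) (s c X Y : ℕ → ℝ) :
    dualKernel m s c X Y =
      (∏ k ∈ Finset.range (m + 2), Real.exp (-((s (k + 1) - s k) / 2) * Y k ^ 2)) *
        (Y 0 * (Y (m + 1))⁻¹) *
      ∏ k ∈ Finset.range (m + 1), Real.exp (-c (k + 1) * X k) *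
        (Real.sin (X k * Y (k + 1)) * Real.sin (X k * Y k)) := by
  rw [Finset.prod_mul_distrib, dualKernel]
  ring

lemma measurable_dualKernel_ext (m : ℕ) (s c : ℕ → ℝ) :
    Measurable fun z : (Fin (m + 1) → ℝ) × (Fin (m + 2) → ℝ) =>
      dualKernel m s c (ext (m + 1) z.1) (ext (m + 2) z.2) := by
  have hx : ∀ k, Measurable fun z : (Fin (m + 1) → ℝ) × (Fin (m + 2) → ℝ) =>
      ext (m + 1) z.1 k := fun k => (measurable_ext _ k).comp measurable_fst
  have hy : ∀ k, Measurable fun z : (Fin (m + 1) → ℝ) × (Fin (m + 2) → ℝ) =>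
      ext (m + 2) z.2 k := fun k => (measurable_ext _ k).comp measurable_snd
  unfold dualKernel
  fun_prop

lemma abs_dualKernel_le {m : ℕ} {s c X Y : ℕ → ℝ} (hX : 0 < X m) (hY0 : 0 < Y 0)
    (hY : 0 < Y (m + 1)) :
    |dualKernel m s c X Y| ≤
      (∏ k ∈ Finset.range (m + 1), (if k = m then X k else 1) * Real.exp (-c (k + 1) * X k)) *
      ∏ k ∈ Finset.range (m + 2),
        (if k = 0 then Y k else 1) * Real.exp (-((s (k + 1) - s k) / 2) * Y k ^ 2) := by
  have h1 : ∏ k ∈ Finset.range (m + 1), (if k = m then X k else 1) = X m := by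
    simp [Finset.prod_ite_eq']
  have h2 : ∏ k ∈ Finset.range (m + 2), (if k = 0 then Y k else 1) = Y 0 := by
    simp [Finset.prod_ite_eq']
  have h3 : |(Y (m + 1))⁻¹ *
      ∏ k ∈ Finset.range (m + 1), (Real.sin (X k * Y (k + 1)) * Real.sin (X k * Y k))| ≤ X m := by
    rw [Finset.prod_range_succ, abs_mul, abs_mul, Finset.abs_prod, abs_mul, abs_inv,
      abs_of_pos hY]
    have hp : ∏ k ∈ Finset.range m, |Real.sin (X k * Y (k + 1)) * Real.sin (X k * Y k)| ≤ 1 := by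
      refine Finset.prod_le_one (fun _ _ => abs_nonneg _) fun k _ => ?_
      rw [abs_mul]
      exact mul_le_one₀ (Real.abs_sin_le_one _) (abs_nonneg _) (Real.abs_sin_le_one _)
    have hq : |Real.sin (X m * Y (m + 1))| ≤ X m * Y (m + 1) := by
      simpa [abs_of_pos (mul_pos hX hY)] using Real.abs_sin_le_abs (x := X m * Y (m + 1))
    calc _ ≤ (Y (m + 1))⁻¹ * (1 * (X m * Y (m + 1) * 1)) := by
          gcongr
          exact Real.abs_sin_le_one _
      _ = X m := by field_simp
  rw [Finset.prod_mul_distrib, Finset.prod_mul_distrib, h1, h2, dualKernel, mul_assoc (Y 0),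
    abs_mul, abs_mul _ (∏ k ∈ Finset.range (m + 2), _), abs_mul (Y 0), abs_of_pos hY0,
    abs_of_nonneg (Finset.prod_nonneg fun _ _ => (Real.exp_pos _).le),
    abs_of_nonneg (Finset.prod_nonneg fun _ _ => (Real.exp_pos _).le)]
  calc _ ≤ (∏ k ∈ Finset.range (m + 1), Real.exp (-c (k + 1) * X k)) *
        (∏ k ∈ Finset.range (m + 2), Real.exp (-((s (k + 1) - s k) / 2) * Y k ^ 2)) *
        (Y 0 * X m) := by gcongr
    _ = _ := by ring

lemma integrable_dualKernel_ext {m : ℕ} {s c : ℕ → ℝ} (hs : ∀ k ≤ m + 1, s k < s (k + 1))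
    (hc : ∀ k ≤ m, 0 < c (k + 1)) :
    Integrable (fun z : (Fin (m + 1) → ℝ) × (Fin (m + 2) → ℝ) =>
        dualKernel m s c (ext (m + 1) z.1) (ext (m + 2) z.2))
      ((Measure.pi fun _ => volume.restrict (Set.Ioi (0 : ℝ))).prod
        (Measure.pi fun _ => volume.restrict (Set.Ioi (0 : ℝ)))) := by
  have hX := integrable_prod_range_ext (n := m + 1) (μ := volume.restrict (Set.Ioi (0 : ℝ)))
    (f := fun k x => (if k = m then x else 1) * Real.exp (-c (k + 1) * x)) (by
      intro k hk
      have hck := hc k (by omega)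
      split_ifs
      · simpa [IntegrableOn] using integrableOn_rpow_mul_exp_neg_mul_rpow (s := 1) (p := 1)
          (by norm_num) one_pos hck
      · simpa [IntegrableOn] using exp_neg_integrableOn_Ioi 0 hck)
  have hY := integrable_prod_range_ext (n := m + 2) (μ := volume.restrict (Set.Ioi (0 : ℝ)))
    (f := fun k y => (if k = 0 then y else 1) *
      Real.exp (-((s (k + 1) - s k) / 2) * y ^ 2)) (by
      intro k hk
      have hsk := sub_pos.2 (hs k (by omega))
      split_ifs
      · exact (integrable_mul_exp_neg_mul_sq (half_pos hsk)).restrict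
      · simpa [IntegrableOn] using integrableOn_Ioi_exp_neg_mul_sq hsk)
  refine (hX.mul_prod hY).mono' (measurable_dualKernel_ext m s c).aestronglyMeasurable ?_
  filter_upwards [Measure.quasiMeasurePreserving_fst.ae (ae_pi_restrict_Ioi_ext_pos (m + 1)),
    Measure.quasiMeasurePreserving_snd.ae (ae_pi_restrict_Ioi_ext_pos (m + 2))] with z h1 h2
  exact abs_dualKernel_le (h1 m (by omega)) (h2 0 (by omega)) (h2 (m + 1) (by omega))

/-- Integrating out the frequencies. -/
lemma integral_dualKernel_freq {m : ℕ} {s : ℕ → ℝ} (c : ℕ → ℝ)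
    (hs : ∀ k ≤ m + 1, s k < s (k + 1)) (X : ℕ → ℝ) :
    ∫ y : Fin (m + 2) → ℝ, dualKernel m s c X (ext (m + 2) y)
        ∂(Measure.pi fun _ => volume.restrict (Set.Ioi (0 : ℝ))) =
      (∏ k ∈ Finset.range (m + 1), Real.exp (-c (k + 1) * X k)) *
        ((∏ k ∈ Finset.range m,
          Real.pi / 2 * ptilde (s (k + 2) - s (k + 1)) (X k) (X (k + 1))) *
        (Real.pi * hexc (1 - (s 1 - s 0)) (X 0)) *
        (Real.pi * htil (1 - (s (m + 2) - s (m + 1))) (X m))) := by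
  simp_rw [dualKernel_eq_prod_freqFactor]
  rw [integral_const_mul, integral_prod_range_ext]
  have hpos : ∀ k ≤ m + 1, 0 < s (k + 1) - s k := fun k hk => sub_pos.2 (hs k hk)
  congr 1
  rw [Finset.prod_range_succ, Finset.prod_range_succ']
  refine congrArg₂ _ (congrArg₂ _ ?_ ?_) ?_
  · refine Finset.prod_congr rfl fun k hk => ?_
    have hk' := Finset.mem_range.1 hk
    rw [← integral_Ioi_exp_neg_mul_sq_mul_sin_mul_sin (hpos (k + 1) (by omega))]
    simp [freqFactor, hk'.ne]
  · rw [← integral_Ioi_exp_neg_mul_sq_mul_id_mul_sin (hpos 0 (by omega))]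
    simp [freqFactor]
  · rw [← integral_Ioi_exp_neg_mul_sq_mul_sin_div (hpos (m + 1) le_rfl)]
    simp [freqFactor]

/-- Integrating out the spatial variables. -/
lemma integral_dualKernel_space {m : ℕ} (s : ℕ → ℝ) {c : ℕ → ℝ} (hc : ∀ k ≤ m, 0 < c (k + 1))
    (Y : ℕ → ℝ) :
    ∫ x : Fin (m + 1) → ℝ, dualKernel m s c (ext (m + 1) x) Y
        ∂(Measure.pi fun _ => volume.restrict (Set.Ioi (0 : ℝ))) =
      (∏ k ∈ Finset.range (m + 2), Real.exp (-((s (k + 1) - s k) / 2) * Y k ^ 2)) *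
        (Y 0 * (Y (m + 1))⁻¹) *
      ∏ k ∈ Finset.range (m + 1), 1 / 2 *
        (c (k + 1) / (c (k + 1) ^ 2 + (Y (k + 1) - Y k) ^ 2) -
          c (k + 1) / (c (k + 1) ^ 2 + (Y (k + 1) + Y k) ^ 2)) := by
  simp_rw [dualKernel_eq_prod_space]
  rw [integral_const_mul, integral_prod_range_ext (fun k x => Real.exp (-c (k + 1) * x) *
    (Real.sin (x * Y (k + 1)) * Real.sin (x * Y k)))]
  congr 1
  refine Finset.prod_congr rfl fun k hk => ?_
  have hk' := Finset.mem_range.1 hk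
  exact integral_Ioi_exp_neg_mul_mul_sin_mul_sin (hc k (by omega)) _ _

/-- The Laplace-weighted density of the meander in terms of the integrated kernel. -/
lemma meander_density_eq_integral_dualKernel {m : ℕ} {s : ℕ → ℝ} (c : ℕ → ℝ) (hs0 : s 0 = 0)
    (hs1 : s (m + 2) = 1) (hs : ∀ k ≤ m + 1, s k < s (k + 1)) {X : ℕ → ℝ}
    (hX : ∀ k < m + 1, 0 < X k) :
    Real.exp (-(∑ k ∈ Finset.range (m + 1), c (k + 1) * X k)) *
        (Real.sqrt (8 * Real.pi) * hexc (1 - s 1) (X 0) * htil (s 1) (X 0)) *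
        ∏ k ∈ Finset.range m,
          (htil (s (k + 2)) (X (k + 1)) / htil (s (k + 1)) (X k)) *
            ptilde (s (k + 2) - s (k + 1)) (X k) (X (k + 1)) =
      Real.sqrt (8 * Real.pi) * (Real.pi ^ 2)⁻¹ * (2 / Real.pi) ^ m *
        ∫ y : Fin (m + 2) → ℝ, dualKernel m s c X (ext (m + 2) y)
          ∂(Measure.pi fun _ => volume.restrict (Set.Ioi (0 : ℝ))) := by
  have hlt : ∀ j ≤ m, s (m + 1 - j) < 1 := by
    intro j hj
    induction j with
    | zero => simpa [hs1] using hs (m + 1) le_rfl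
    | succ j ih =>
      have h := hs (m + 1 - (j + 1)) (by omega)
      rw [show m + 1 - (j + 1) + 1 = m + 1 - j by omega] at h
      exact h.trans (ih (by omega))
  have htel := mul_prod_range_div_eq (f := fun k => htil (s (k + 1)) (X k)) (m := m)
    fun k hk => (htil_pos (by
      have := hlt (m - k) (by omega)
      rwa [show m + 1 - (m - k) = k + 1 by omega] at this) (hX k (by omega))).ne'
  have hexp : Real.exp (-(∑ k ∈ Finset.range (m + 1), c (k + 1) * X k)) =
      ∏ k ∈ Finset.range (m + 1), Real.exp (-c (k + 1) * X k) := by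
    rw [← Real.exp_sum, ← Finset.sum_neg_distrib]
    simp only [neg_mul]
  have hpi : (Real.pi ^ 2)⁻¹ * (2 / Real.pi) ^ m * ((Real.pi / 2) ^ m * Real.pi * Real.pi) = 1 := by
    rw [← inv_div Real.pi 2, inv_pow]
    field_simp
  rw [integral_dualKernel_freq c hs, hs0, hs1, sub_zero, sub_sub_cancel, Finset.prod_mul_distrib,
    Finset.prod_mul_distrib, Finset.prod_const, Finset.card_range, hexp, ← htel]
  generalize (∏ k ∈ Finset.range m, htil (s (k + 2)) (X (k + 1)) / htil (s (k + 1)) (X k)) = P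
  generalize (∏ k ∈ Finset.range m, ptilde (s (k + 2) - s (k + 1)) (X k) (X (k + 1))) = Q
  generalize (∏ k ∈ Finset.range (m + 1), Real.exp (-c (k + 1) * X k)) = E
  linear_combination
    -(E * (Real.sqrt (8 * Real.pi) * hexc (1 - s 1) (X 0) * htil (s 1) (X 0)) * (P * Q)) * hpi

/-- The Gaussian-weighted product of reversed radial Cauchy kernels in terms of the integrated
kernel. -/
lemma radial_kernel_eq_integral_dualKernel {m : ℕ} (s : ℕ → ℝ) {c t : ℕ → ℝ}
    (hc : ∀ k ≤ m, 0 < c (k + 1)) (ht : ∀ k, t k = ∑ j ∈ Finset.range k, c (j + 1)) {Y : ℕ → ℝ}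
    (hY : ∀ k < m + 2, 0 < Y k) :
    Real.exp (-(1 / 2) * ∑ k ∈ Finset.range (m + 2), (s (k + 1) - s k) * Y k ^ 2) *
        ∏ k ∈ Finset.range (m + 1), qrad (t (k + 1) - t k) (Y (k + 1)) (Y k) =
      (2 / Real.pi) ^ (m + 1) *
        ∫ x : Fin (m + 1) → ℝ, dualKernel m s c (ext (m + 1) x) Y
          ∂(Measure.pi fun _ => volume.restrict (Set.Ioi (0 : ℝ))) := by
  have htel := mul_prod_range_div_eq (f := fun k => (Y k)⁻¹) (m := m + 1)
    fun k hk => inv_ne_zero (hY k (by omega)).ne'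
  have hexp : Real.exp (-(1 / 2) * ∑ k ∈ Finset.range (m + 2), (s (k + 1) - s k) * Y k ^ 2) =
      ∏ k ∈ Finset.range (m + 2), Real.exp (-((s (k + 1) - s k) / 2) * Y k ^ 2) := by
    rw [← Real.exp_sum, Finset.mul_sum]
    congr 1
    exact Finset.sum_congr rfl fun k _ => by ring
  have hq : ∏ k ∈ Finset.range (m + 1), qrad (t (k + 1) - t k) (Y (k + 1)) (Y k) =
      (∏ k ∈ Finset.range (m + 1), (Y (k + 1))⁻¹ / (Y k)⁻¹) * ((2 / Real.pi) ^ (m + 1) *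
      ∏ k ∈ Finset.range (m + 1), 1 / 2 *
        (c (k + 1) / (c (k + 1) ^ 2 + (Y (k + 1) - Y k) ^ 2) -
          c (k + 1) / (c (k + 1) ^ 2 + (Y (k + 1) + Y k) ^ 2))) := by
    rw [← Finset.card_range (m + 1), ← Finset.prod_const, Finset.card_range,
      ← Finset.prod_mul_distrib, ← Finset.prod_mul_distrib]
    refine Finset.prod_congr rfl fun k _ => ?_
    rw [qrad, ht, ht, Finset.sum_range_succ, add_sub_cancel_left]
    simp only [div_eq_mul_inv, inv_inv]
    ring
  have h0 := (hY 0 (by omega)).ne'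
  rw [integral_dualKernel_space s hc, hexp, hq, ← htel]
  field_simp

/-- Dual representation of the Laplace transform of the Brownian meander:
`E[exp(−Σ_{k=1}^n cₖ B^{me}_{s̃ₖ})]
  = √(2/π)∫₀^∞ E[exp(−½Σₖ(s̃ₖ₊₁−s̃ₖ)Y²_{tₖ}) | Y_{tₙ}=y] dy`,
written out via the joint densities and the reversed kernels `q_{Δt}(yₖ, yₖ₋₁)`.
Here `x 0, …, x (n-1)` play the roles of `x₁, …, xₙ` and `y 0, …, y n` of `y₀, …, yₙ`. -/
theorem statement7 (n : ℕ) (hn : 1 ≤ n) (s : ℕ → ℝ) (c : ℕ → ℝ) (t : ℕ → ℝ)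
    (hs0 : s 0 = 0) (hs1 : s (n + 1) = 1) (hsmono : ∀ k ≤ n, s k < s (k + 1))
    (hc : ∀ k, 1 ≤ k → k ≤ n → 0 < c k)
    (ht : ∀ k, t k = ∑ j ∈ Finset.range k, c (j + 1)) :
    Integrable
      (fun x : Fin n → ℝ =>
        Real.exp (-(∑ k ∈ Finset.range n, c (k + 1) * ext n x k)) *
          (Real.sqrt (8 * Real.pi) * hexc (1 - s 1) (ext n x 0) * htil (s 1) (ext n x 0)) *
          ∏ k ∈ Finset.range (n - 1),
            (htil (s (k + 2)) (ext n x (k + 1)) / htil (s (k + 1)) (ext n x k)) *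
              ptilde (s (k + 2) - s (k + 1)) (ext n x k) (ext n x (k + 1)))
      (Measure.pi fun _ : Fin n => volume.restrict (Set.Ioi (0 : ℝ))) ∧
    Integrable
      (fun y : Fin (n + 1) → ℝ =>
        Real.exp (-(1 / 2) * ∑ k ∈ Finset.range (n + 1),
            (s (k + 1) - s k) * (ext (n + 1) y k) ^ 2) *
          ∏ k ∈ Finset.range n,
            qrad (t (k + 1) - t k) (ext (n + 1) y (k + 1)) (ext (n + 1) y k))
      (Measure.pi fun _ : Fin (n + 1) => volume.restrict (Set.Ioi (0 : ℝ))) ∧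
    (∫ x : Fin n → ℝ,
        Real.exp (-(∑ k ∈ Finset.range n, c (k + 1) * ext n x k)) *
          (Real.sqrt (8 * Real.pi) * hexc (1 - s 1) (ext n x 0) * htil (s 1) (ext n x 0)) *
          ∏ k ∈ Finset.range (n - 1),
            (htil (s (k + 2)) (ext n x (k + 1)) / htil (s (k + 1)) (ext n x k)) *
              ptilde (s (k + 2) - s (k + 1)) (ext n x k) (ext n x (k + 1))
        ∂(Measure.pi fun _ : Fin n => volume.restrict (Set.Ioi (0 : ℝ))))
      = Real.sqrt (2 / Real.pi) *
        ∫ y : Fin (n + 1) → ℝ,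
          Real.exp (-(1 / 2) * ∑ k ∈ Finset.range (n + 1),
              (s (k + 1) - s k) * (ext (n + 1) y k) ^ 2) *
            ∏ k ∈ Finset.range n,
              qrad (t (k + 1) - t k) (ext (n + 1) y (k + 1)) (ext (n + 1) y k)
          ∂(Measure.pi fun _ : Fin (n + 1) => volume.restrict (Set.Ioi (0 : ℝ))) := by
  obtain ⟨m, rfl⟩ : ∃ m, n = m + 1 := ⟨n - 1, by omega⟩
  have hc' : ∀ k ≤ m, 0 < c (k + 1) := fun k hk => hc (k + 1) (by omega) (by omega)
  have hK := integrable_dualKernel_ext hsmono hc'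
  have hL := (ae_pi_restrict_Ioi_ext_pos (m + 1)).mono fun x hx =>
    meander_density_eq_integral_dualKernel c hs0 hs1 hsmono hx
  have hR := (ae_pi_restrict_Ioi_ext_pos (m + 2)).mono fun y hy =>
    radial_kernel_eq_integral_dualKernel s hc' ht hy
  refine ⟨(hK.integral_prod_left.const_mul _).congr (hL.mono fun _ h => h.symm),
    (hK.integral_prod_right.const_mul _).congr (hR.mono fun _ h => h.symm), ?_⟩
  have hconst : Real.sqrt (8 * Real.pi) = Real.sqrt (2 / Real.pi) * (2 * Real.pi) := by
    rw [show 8 * Real.pi = 2 / Real.pi * (2 * Real.pi) ^ 2 by field_simp; norm_num,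
      Real.sqrt_mul (by positivity), Real.sqrt_sq (by positivity)]
  refine (integral_congr_ae hL).trans (Eq.trans ?_
    (congrArg (Real.sqrt (2 / Real.pi) * ·) (integral_congr_ae hR).symm))
  simp only [integral_const_mul]
  rw [integral_integral_swap (f := fun x y => dualKernel m s c (ext (m + 1) x) (ext (m + 2) y)) hK,
    hconst]
  field_simp
  rw [pow_succ]
  field_simp
end

section
/- For all t₁, t₂ > 0 and all y₁, y₃ > 0, the Chapman–Kolmogorov identity ∫₀^∞ q_{t₁}(y₁, y) · q_{t₂}(y, y₃) dy = q_{t₁+t₂}(y₁, y₃) holds; that is, the kernels q_t form a Markov transition semigroup on (0,∞). -/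
open MeasureTheory

open Filter Topology

/-- The Cauchy kernel `t / (t ^ 2 + x ^ 2)`, without the factor `1 / π`. -/
noncomputable def cauchyKernel (t x : ℝ) : ℝ := t / (t ^ 2 + x ^ 2)

lemma cauchyKernel_neg (t x : ℝ) : cauchyKernel t (-x) = cauchyKernel t x := by
  simp [cauchyKernel]

lemma continuous_cauchyKernel {t : ℝ} (ht : 0 < t) : Continuous (cauchyKernel t) := by
  unfold cauchyKernel
  exact continuous_const.div (by fun_prop) fun x => by positivity

lemma cauchyKernel_eq_inv_one_add_sq {t : ℝ} (ht : 0 < t) (x : ℝ) :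
    cauchyKernel t x = t⁻¹ * (1 + (x / t) ^ 2)⁻¹ := by
  unfold cauchyKernel
  field_simp

lemma integrable_cauchyKernel {t : ℝ} (ht : 0 < t) : Integrable (cauchyKernel t) := by
  simp_rw [funext (cauchyKernel_eq_inv_one_add_sq ht)]
  exact (integrable_inv_one_add_sq.comp_div ht.ne').const_mul _

lemma norm_cauchyKernel_le {t : ℝ} (ht : 0 < t) (x : ℝ) : ‖cauchyKernel t x‖ ≤ t⁻¹ := by
  unfold cauchyKernel
  rw [Real.norm_of_nonneg (by positivity), div_le_iff₀ (by positivity), inv_mul_eq_div,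
    le_div_iff₀ ht]
  nlinarith [sq_nonneg x]

lemma integrable_cauchyKernel_mul {s t : ℝ} (hs : 0 < s) (ht : 0 < t) (a b : ℝ) :
    Integrable fun y => cauchyKernel s (y - a) * cauchyKernel t (y - b) :=
  ((integrable_cauchyKernel ht).comp_sub_right b).bdd_mul (c := s⁻¹)
    ((continuous_cauchyKernel hs).comp (continuous_id.sub continuous_const)).aestronglyMeasurable
    (Filter.Eventually.of_forall fun y => norm_cauchyKernel_le hs (y - a))

lemma hasDerivAt_arctan_sub_div {t : ℝ} (ht : 0 < t) (a y : ℝ) :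
    HasDerivAt (fun y => Real.arctan ((y - a) / t)) (cauchyKernel t (y - a)) y := by
  refine (((hasDerivAt_id y).sub_const a).div_const t).arctan.congr_deriv ?_
  rw [cauchyKernel_eq_inv_one_add_sq ht]
  simp [mul_comm]

lemma hasDerivAt_log_sq_add_sq {t : ℝ} (ht : 0 < t) (a y : ℝ) :
    HasDerivAt (fun y => Real.log (t ^ 2 + (y - a) ^ 2))
      (2 * (y - a) / (t ^ 2 + (y - a) ^ 2)) y := by
  refine (((((hasDerivAt_id y).sub_const a).fun_pow 2).const_add (t ^ 2)).log
    (by positivity)).congr_deriv ?_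
  simp

lemma tendsto_arctan_sub_div_atTop {t : ℝ} (ht : 0 < t) (a : ℝ) :
    Tendsto (fun y => Real.arctan ((y - a) / t)) atTop (𝓝 (Real.pi / 2)) :=
  (Real.tendsto_arctan_atTop.mono_right nhdsWithin_le_nhds).comp
    ((tendsto_atTop_add_const_right _ (-a) tendsto_id).atTop_div_const ht)

lemma tendsto_arctan_sub_div_atBot {t : ℝ} (ht : 0 < t) (a : ℝ) :
    Tendsto (fun y => Real.arctan ((y - a) / t)) atBot (𝓝 (-(Real.pi / 2))) :=
  (Real.tendsto_arctan_atBot.mono_right nhdsWithin_le_nhds).comp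
    ((tendsto_atBot_add_const_right _ (-a) tendsto_id).atBot_div_const ht)

/-- The difference of two logarithms of quadratics with the same leading term vanishes at
infinity. -/
lemma tendsto_log_sub_log_atTop {s t : ℝ} (hs : 0 < s) (ht : 0 < t) (a b : ℝ) :
    Tendsto (fun y => Real.log (s ^ 2 + (y - a) ^ 2) - Real.log (t ^ 2 + (y - b) ^ 2))
      atTop (𝓝 0) := by
  have key : ∀ r c : ℝ, Tendsto (fun y : ℝ => r ^ 2 * (y⁻¹) ^ 2 + (1 - c * y⁻¹) ^ 2)
      atTop (𝓝 1) := fun r c => by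
    have h := tendsto_inv_atTop_zero (𝕜 := ℝ)
    simpa using ((h.pow 2).const_mul (r ^ 2)).add (((h.const_mul c).const_sub 1).pow 2)
  have h := ((key s a).log one_ne_zero).sub ((key t b).log one_ne_zero)
  rw [sub_self] at h
  refine h.congr' ?_
  filter_upwards [eventually_gt_atTop 0] with y hy
  have hlog : ∀ r c : ℝ, 0 < r → Real.log (r ^ 2 * (y⁻¹) ^ 2 + (1 - c * y⁻¹) ^ 2)
      = Real.log (r ^ 2 + (y - c) ^ 2) - Real.log (y ^ 2) := fun r c hr => by
    rw [← Real.log_div (by positivity) (by positivity)]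
    congr 1
    field_simp
  rw [hlog s a hs, hlog t b ht]
  ring

lemma tendsto_log_sub_log_atBot {s t : ℝ} (hs : 0 < s) (ht : 0 < t) (a b : ℝ) :
    Tendsto (fun y => Real.log (s ^ 2 + (y - a) ^ 2) - Real.log (t ^ 2 + (y - b) ^ 2))
      atBot (𝓝 0) := by
  refine ((tendsto_log_sub_log_atTop hs ht (-a) (-b)).comp tendsto_neg_atBot_atTop).congr
    fun y => ?_
  simp only [Function.comp_apply]
  ring_nf

/-- Convolution of two Cauchy kernels in the coincident case. -/
lemma integral_cauchyKernel_sq {t : ℝ} (ht : 0 < t) (a : ℝ) :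
    ∫ y, cauchyKernel t (y - a) * cauchyKernel t (y - a) = Real.pi * cauchyKernel (t + t) 0 := by
  have hlim : ∀ l : Filter ℝ, Tendsto (fun y : ℝ => y⁻¹) l (𝓝 0) → (∀ᶠ y in l, y ≠ 0) →
      Tendsto (fun y : ℝ => y / (2 * (t ^ 2 + y ^ 2))) l (𝓝 0) := fun l h hne => by
    have h2 := h.div (((h.pow 2).const_mul (t ^ 2)).add_const 1 |>.const_mul 2) (by simp)
    rw [zero_div] at h2
    refine h2.congr' ?_
    filter_upwards [hne] with y hy
    simp only [Pi.div_apply]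
    field_simp
  have hder : ∀ y, HasDerivAt
      (fun y => (2 * t)⁻¹ * Real.arctan ((y - 0) / t) + y / (2 * (t ^ 2 + y ^ 2)))
      (cauchyKernel t y * cauchyKernel t y) y := fun y => by
    have h1 := (hasDerivAt_arctan_sub_div ht 0 y).const_mul (2 * t)⁻¹
    have h2 := (hasDerivAt_id y).div
      ((((hasDerivAt_id y).fun_pow 2).const_add (t ^ 2)).const_mul 2) (by positivity)
    refine (h1.add h2).congr_deriv ?_
    simp [cauchyKernel]
    field_simp
    ring
  have hT := ((tendsto_arctan_sub_div_atTop ht 0).const_mul (2 * t)⁻¹).add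
    (hlim _ tendsto_inv_atTop_zero (eventually_ne_atTop 0))
  have hB := ((tendsto_arctan_sub_div_atBot ht 0).const_mul (2 * t)⁻¹).add
    (hlim _ tendsto_inv_atBot_zero (eventually_ne_atBot 0))
  have hint := integrable_cauchyKernel_mul ht ht 0 0
  simp only [sub_zero] at hint
  rw [integral_sub_right_eq_self (fun y => cauchyKernel t y * cauchyKernel t y) a,
    integral_of_hasDerivAt_of_tendsto hder hint hB hT]
  simp only [cauchyKernel]
  field_simp
  ring

/-- Convolution semigroup property of the Cauchy kernels. -/
theorem integral_cauchyKernel_mul {s t : ℝ} (hs : 0 < s) (ht : 0 < t) (a b : ℝ) :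
    ∫ y, cauchyKernel s (y - a) * cauchyKernel t (y - b)
      = Real.pi * cauchyKernel (s + t) (a - b) := by
  by_cases hst : s = t ∧ a = b
  · obtain ⟨rfl, rfl⟩ := hst
    rw [sub_self]
    exact integral_cauchyKernel_sq hs a
  have hK : 0 < (a - b) ^ 2 + (s - t) ^ 2 := by
    by_contra! h
    exact hst ⟨by nlinarith [sq_nonneg (a - b), sq_nonneg (s - t)],
      by nlinarith [sq_nonneg (a - b), sq_nonneg (s - t)]⟩
  have hL : 0 < (a - b) ^ 2 + (s + t) ^ 2 := by positivity
  set K := ((a - b) ^ 2 + (s - t) ^ 2) * ((a - b) ^ 2 + (s + t) ^ 2) with hKdef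
  have hK0 : K ≠ 0 := by positivity
  have hder : ∀ y, HasDerivAt (fun y =>
      -(s * t * (a - b) / K) *
        (Real.log (s ^ 2 + (y - a) ^ 2) - Real.log (t ^ 2 + (y - b) ^ 2)) +
      (t * (t ^ 2 - s ^ 2 + (a - b) ^ 2) / K * Real.arctan ((y - a) / s) +
       s * (s ^ 2 - t ^ 2 + (a - b) ^ 2) / K * Real.arctan ((y - b) / t)))
      (cauchyKernel s (y - a) * cauchyKernel t (y - b)) y := fun y => by
    refine ((((hasDerivAt_log_sq_add_sq hs a y).sub
      (hasDerivAt_log_sq_add_sq ht b y)).const_mul (-(s * t * (a - b) / K))).add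
      (((hasDerivAt_arctan_sub_div hs a y).const_mul _).add
        ((hasDerivAt_arctan_sub_div ht b y).const_mul _))).congr_deriv ?_
    have h1 : s ^ 2 + (y - a) ^ 2 ≠ 0 := by positivity
    have h2 : t ^ 2 + (y - b) ^ 2 ≠ 0 := by positivity
    simp only [cauchyKernel]
    field_simp
    rw [hKdef]
    ring
  have hT := ((tendsto_log_sub_log_atTop hs ht a b).const_mul (-(s * t * (a - b) / K))).add
    (((tendsto_arctan_sub_div_atTop hs a).const_mul
      (t * (t ^ 2 - s ^ 2 + (a - b) ^ 2) / K)).add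
    ((tendsto_arctan_sub_div_atTop ht b).const_mul (s * (s ^ 2 - t ^ 2 + (a - b) ^ 2) / K)))
  have hB := ((tendsto_log_sub_log_atBot hs ht a b).const_mul (-(s * t * (a - b) / K))).add
    (((tendsto_arctan_sub_div_atBot hs a).const_mul
      (t * (t ^ 2 - s ^ 2 + (a - b) ^ 2) / K)).add
    ((tendsto_arctan_sub_div_atBot ht b).const_mul (s * (s ^ 2 - t ^ 2 + (a - b) ^ 2) / K)))
  rw [integral_of_hasDerivAt_of_tendsto hder (integrable_cauchyKernel_mul hs ht a b) hB hT]
  have hL' : (s + t) ^ 2 + (a - b) ^ 2 ≠ 0 := by positivity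
  simp only [cauchyKernel]
  field_simp
  rw [hKdef]
  ring

lemma integral_Ioi_add_comp_neg {f : ℝ → ℝ} (hf : Integrable f) :
    ∫ y in Set.Ioi (0 : ℝ), (f y + f (-y)) = ∫ y, f y := by
  rw [integral_add hf.integrableOn hf.comp_neg.integrableOn, integral_comp_neg_Ioi, neg_zero,
    add_comm, ← setIntegral_union (by simp) measurableSet_Ioi hf.integrableOn hf.integrableOn,
    Set.Iic_union_Ioi, setIntegral_univ]

/-- On the half line the product of radial kernels is an even reflection of products of Cauchy
kernels. -/
lemma qrad_mul_qrad (s t a b : ℝ) {y : ℝ} (hy : 0 < y) :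
    qrad s a y * qrad t y b = b / a * (1 / Real.pi ^ 2) *
      ((cauchyKernel s (y - a) * cauchyKernel t (y - b) -
          cauchyKernel s (y - -a) * cauchyKernel t (y - b)) +
        (cauchyKernel s (-y - a) * cauchyKernel t (-y - b) -
          cauchyKernel s (-y - -a) * cauchyKernel t (-y - b))) := by
  rw [← cauchyKernel_neg s (y - a), ← cauchyKernel_neg s (-y - a), ← cauchyKernel_neg t (-y - b),
    ← cauchyKernel_neg s (-y - -a)]
  simp only [qrad, cauchyKernel]
  have hy' := hy.ne'
  rw [show -(y - a) = a - y by ring, show y - -a = a + y by ring, show -(-y - a) = a + y by ring,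
    show -(-y - b) = y + b by ring, show -(-y - -a) = -(a - y) by ring, neg_sq]
  have : y / a * (1 / Real.pi) * (b / y * (1 / Real.pi)) = b / a * (1 / Real.pi ^ 2) := by
    field_simp
  rw [← this]
  ring

/-- Chapman–Kolmogorov identity for the radial Cauchy kernels. -/
theorem statement14 (t₁ t₂ : ℝ) (ht₁ : 0 < t₁) (ht₂ : 0 < t₂)
    (y₁ y₃ : ℝ) (hy₁ : 0 < y₁) (hy₃ : 0 < y₃) :
    IntegrableOn (fun y : ℝ => qrad t₁ y₁ y * qrad t₂ y y₃) (Set.Ioi 0) ∧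
    ∫ y in Set.Ioi (0 : ℝ), qrad t₁ y₁ y * qrad t₂ y y₃ = qrad (t₁ + t₂) y₁ y₃ := by
  have hA := integrable_cauchyKernel_mul ht₁ ht₂ y₁ y₃
  have hB := integrable_cauchyKernel_mul ht₁ ht₂ (-y₁) y₃
  have hf := hA.sub hB
  have heq : Set.EqOn (fun y : ℝ => qrad t₁ y₁ y * qrad t₂ y y₃) _ (Set.Ioi 0) :=
    fun y hy => qrad_mul_qrad t₁ t₂ y₁ y₃ hy
  constructor
  · rw [integrableOn_congr_fun heq measurableSet_Ioi]
    exact ((hf.add hf.comp_neg).const_mul _).integrableOn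
  · rw [setIntegral_congr_fun measurableSet_Ioi heq, integral_const_mul]
    have h := integral_Ioi_add_comp_neg hf
    simp only [Pi.sub_apply] at h
    rw [h, integral_sub hA hB, integral_cauchyKernel_mul ht₁ ht₂,
      integral_cauchyKernel_mul ht₁ ht₂, ← cauchyKernel_neg _ (-y₁ - y₃),
      show -(-y₁ - y₃) = y₁ + y₃ by ring]
    simp only [qrad, cauchyKernel]
    field_simp
end
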